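/- Let C₁, C₂, C₃ be unital C*-subalgebras of B(H) (H separable Hilbert) each having nonempty character space, C the C*-algebra they generate, and C̃ = C/com(C). Then the maximal ideal space of C̃ is homeomorphic to the set P(C₁,C₂,C₃) of triples (x₁,x₂,x₃) ∈ M(C₁)×M(C₂)×M(C₃) satisfying: for all aᵢ ∈ Cᵢ with 0 ≤ aᵢ ≤ 1 and xᵢ(aᵢ)=1 for i=1,2,3, one has ‖a₁a₂a₃‖ = 1 (Power's theorem). -/

import Mathlib

open WeakDual ContinuousLinearMap

set_option maxHeartbeats 1000000

noncomputable section

/-- `0 ≤ a ≤ 1` for an operator on a Hilbert space: `a` and `1 - a` are positive. -/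
def IsBetweenZeroOne {H : Type*} [NormedAddCommGroup H] [InnerProductSpace ℂ H]
    [CompleteSpace H] (a : H →L[ℂ] H) : Prop :=
  a.IsPositive ∧ (1 - a).IsPositive

section PowerAux

open Filter Topology

variable {H : Type*} [NormedAddCommGroup H] [InnerProductSpace ℂ H] [CompleteSpace H]

lemma compl_apply (a : H →L[ℂ] H) (x : H) : (1 - a) x = x - a x := rfl

lemma IsBetweenZeroOne.compl {a : H →L[ℂ] H} (h : IsBetweenZeroOne a) :
    IsBetweenZeroOne (1 - a) := ⟨h.2, by simpa using h.1⟩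

lemma IsBetweenZeroOne.norm_sq_le {a : H →L[ℂ] H} (h : IsBetweenZeroOne a) (x : H) :
    ‖a x‖ ^ 2 ≤ (inner ℂ (a x) x).re := by
  have h1 := h.2.re_inner_nonneg_left (a x)
  have h2 := h.1.re_inner_nonneg_left ((1 - a) x)
  have e1 : inner ℂ (a (a x)) x = inner ℂ (a x) (a x) := h.1.inner_left_eq_inner_right _ _
  have e3 : (inner ℂ (a x) (a x)).re = ‖a x‖ ^ 2 := by
    rw [inner_self_eq_norm_sq_to_K]; norm_cast
  simp only [compl_apply, inner_sub_left,
    inner_sub_right, map_sub, e1, RCLike.re_to_complex] at h1 h2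
  linarith

lemma IsBetweenZeroOne.re_le {a : H →L[ℂ] H} (h : IsBetweenZeroOne a) (x : H) :
    (inner ℂ (a x) x).re ≤ ‖x‖ ^ 2 := by
  have h1 := h.2.re_inner_nonneg_left x
  have e3 : (inner ℂ x x).re = ‖x‖ ^ 2 := by
    rw [inner_self_eq_norm_sq_to_K]; norm_cast
  simp only [compl_apply, inner_sub_left,
    map_sub, RCLike.re_to_complex] at h1
  linarith

lemma IsBetweenZeroOne.apply_le {a : H →L[ℂ] H} (h : IsBetweenZeroOne a) (x : H) :
    ‖a x‖ ≤ ‖x‖ :=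
  le_of_sq_le_sq ((h.norm_sq_le x).trans (h.re_le x)) (norm_nonneg _)

lemma IsBetweenZeroOne.norm_le_one {a : H →L[ℂ] H} (h : IsBetweenZeroOne a) : ‖a‖ ≤ 1 :=
  a.opNorm_le_bound zero_le_one (fun x => by simpa using h.apply_le x)

lemma re_inner_compl (a : H →L[ℂ] H) (x : H) :
    (inner ℂ ((1 - a) x) x).re = ‖x‖ ^ 2 - (inner ℂ (a x) x).re := by
  have e3 : (inner ℂ x x).re = ‖x‖ ^ 2 := by
    rw [inner_self_eq_norm_sq_to_K]; norm_cast
  rw [compl_apply, inner_sub_left, Complex.sub_re, e3]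

lemma IsBetweenZeroOne.tendsto {a : H →L[ℂ] H} (h : IsBetweenZeroOne a) {u : ℕ → H}
    (hu : ∀ n, ‖u n‖ = 1) (hlim : Tendsto (fun n => ‖a (u n)‖) atTop (𝓝 1)) :
    Tendsto (fun n => (inner ℂ ((1 - a) (u n)) (u n)).re) atTop (𝓝 0) ∧
      Tendsto (fun n => ‖(1 - a) (u n)‖) atTop (𝓝 0) := by
  have h1 : Tendsto (fun n => (inner ℂ ((1 - a) (u n)) (u n)).re) atTop (𝓝 0) := by
    have h0 : Tendsto (fun n => 1 - ‖a (u n)‖ ^ 2) atTop (𝓝 0) := by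
      simpa using (hlim.pow 2).const_sub 1
    refine squeeze_zero (fun n => ?_) (fun n => ?_) h0
    · exact h.2.re_inner_nonneg_left (u n)
    · rw [re_inner_compl, hu]
      have := h.norm_sq_le (u n)
      linarith
  refine ⟨h1, ?_⟩
  have h2 : Tendsto (fun n => ‖(1 - a) (u n)‖ ^ 2) atTop (𝓝 0) :=
    squeeze_zero (fun n => by positivity) (fun n => h.compl.norm_sq_le (u n)) h1
  simpa using h2.sqrt

/-- Almost fixed vectors from the norm condition. -/
lemma exists_unit_of_norm_eq_one {a₁ a₂ a₃ : H →L[ℂ] H} (h₁ : IsBetweenZeroOne a₁)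
    (h₂ : IsBetweenZeroOne a₂) (h₃ : IsBetweenZeroOne a₃) (hn : ‖a₁ * a₂ * a₃‖ = 1)
    {ε : ℝ} (hε : 0 < ε) :
    ∃ x : H, ‖x‖ = 1 ∧ (inner ℂ ((1 - a₁) x) x).re < ε ∧ (inner ℂ ((1 - a₂) x) x).re < ε ∧
      (inner ℂ ((1 - a₃) x) x).re < ε := by
  have key : ∀ n : ℕ, ∃ x : H, ‖x‖ = 1 ∧ 1 - 1 / ((n : ℝ) + 1) ≤ ‖a₁ (a₂ (a₃ x))‖ := by
    intro n
    have hpos : 0 < 1 / ((n : ℝ) + 1) := by positivity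
    have hle : 1 / ((n : ℝ) + 1) ≤ 1 := by
      rw [div_le_one (by positivity)]; linarith [(Nat.cast_nonneg n : (0 : ℝ) ≤ n)]
    obtain ⟨y, hy, hy'⟩ := (a₁ * a₂ * a₃).exists_lt_apply_of_lt_opNorm
      (r := 1 - 1 / ((n : ℝ) + 1)) (by rw [hn]; linarith)
    have hy0 : y ≠ 0 := by
      rintro rfl
      simp only [map_zero, norm_zero] at hy'
      linarith
    have hyp : 0 < ‖y‖ := norm_pos_iff.2 hy0
    refine ⟨((‖y‖⁻¹ : ℝ) : ℂ) • y, ?_, ?_⟩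
    · rw [norm_smul]; simp [hyp.ne']
    · simp only [map_smul, norm_smul, Complex.norm_real, norm_inv, norm_norm]
      have : 1 ≤ ‖y‖⁻¹ := (one_le_inv₀ hyp).2 hy.le
      change _ < ‖a₁ (a₂ (a₃ y))‖ at hy'
      nlinarith [norm_nonneg (a₁ (a₂ (a₃ y)))]
  choose u hu hu' using key
  have l0 : Tendsto (fun n : ℕ => 1 - 1 / ((n : ℝ) + 1)) atTop (𝓝 1) := by
    simpa using (tendsto_one_div_add_atTop_nhds_zero_nat (𝕜 := ℝ)).const_sub 1
  have t3 := h₃.tendsto hu (tendsto_of_tendsto_of_tendsto_of_le_of_le l0 tendsto_const_nhds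
    (fun n => (hu' n).trans ((h₁.apply_le _).trans (h₂.apply_le _)))
    (fun n => (h₃.apply_le _).trans (hu n).le))
  have l1 : Tendsto (fun n : ℕ => 1 - 1 / ((n : ℝ) + 1) - ‖(1 - a₃) (u n)‖) atTop (𝓝 1) := by
    simpa using l0.sub t3.2
  have i3 : ∀ n, a₃ (u n) = u n - (1 - a₃) (u n) := fun n => by simp
  have i2 : ∀ n, a₂ (u n) = u n - (1 - a₂) (u n) := fun n => by simp
  have b12 : ∀ n : ℕ, 1 - 1 / ((n : ℝ) + 1) - ‖(1 - a₃) (u n)‖ ≤ ‖a₁ (a₂ (u n))‖ := by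
    intro n
    have h := hu' n
    rw [i3, map_sub, map_sub] at h
    have e := norm_sub_le (a₁ (a₂ (u n))) (a₁ (a₂ ((1 - a₃) (u n))))
    have e' := (h₁.apply_le (a₂ ((1 - a₃) (u n)))).trans (h₂.apply_le ((1 - a₃) (u n)))
    linarith
  have t2 := h₂.tendsto hu (tendsto_of_tendsto_of_tendsto_of_le_of_le l1 tendsto_const_nhds
    (fun n => (b12 n).trans (h₁.apply_le _)) (fun n => (h₂.apply_le _).trans (hu n).le))
  have l2 : Tendsto (fun n : ℕ => 1 - 1 / ((n : ℝ) + 1) - ‖(1 - a₃) (u n)‖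
      - ‖(1 - a₂) (u n)‖) atTop (𝓝 1) := by
    simpa using l1.sub t2.2
  have b1 : ∀ n : ℕ, 1 - 1 / ((n : ℝ) + 1) - ‖(1 - a₃) (u n)‖ - ‖(1 - a₂) (u n)‖
      ≤ ‖a₁ (u n)‖ := by
    intro n
    have h := b12 n
    rw [i2, map_sub] at h
    have e := norm_sub_le (a₁ (u n)) (a₁ ((1 - a₂) (u n)))
    have e' := h₁.apply_le ((1 - a₂) (u n))
    linarith
  have t1 := h₁.tendsto hu (tendsto_of_tendsto_of_tendsto_of_le_of_le l2 tendsto_const_nhds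
    b1 (fun n => (h₁.apply_le _).trans (hu n).le))
  obtain ⟨n, hn1, hn2, hn3⟩ := ((t1.1.eventually_lt_const hε).and
    ((t2.1.eventually_lt_const hε).and (t3.1.eventually_lt_const hε))).exists
  exact ⟨u n, hu n, hn1, hn2, hn3⟩

/-- `T` has approximate eigenvalue `l` along the ultrafilter `U`. -/
def ApproxEig (U : Ultrafilter H) (T : H →L[ℂ] H) (l : ℂ) : Prop :=
  Tendsto (fun x => T x - l • x) U (𝓝 0)

variable {U : Ultrafilter H}

lemma ApproxEig.add {S T : H →L[ℂ] H} {l m : ℂ} (hS : ApproxEig U S l) (hT : ApproxEig U T m) :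
    ApproxEig U (S + T) (l + m) := by
  have := Tendsto.add hS hT
  rw [add_zero] at this
  refine this.congr fun x => ?_
  simp only [add_apply, add_smul]; abel

lemma ApproxEig.mul {S T : H →L[ℂ] H} {l m : ℂ} (hS : ApproxEig U S l) (hT : ApproxEig U T m) :
    ApproxEig U (S * T) (l * m) := by
  have h1 := (S.continuous.tendsto 0).comp hT
  have h2 := Tendsto.const_smul hS m
  have := h1.add h2
  rw [smul_zero, map_zero, add_zero] at this
  refine this.congr fun x => ?_
  change S (T x - m • x) + m • (S x - l • x) = S (T x) - (l * m) • x
  simp only [map_sub, map_smul, smul_sub, smul_smul, mul_comm l m]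
  abel

lemma approxEig_algebraMap (c : ℂ) : ApproxEig U (algebraMap ℂ (H →L[ℂ] H) c) c := by
  unfold ApproxEig
  simp [Algebra.algebraMap_eq_smul_one]

lemma ApproxEig.unique (hU : ∀ᶠ x in (U : Filter H), ‖x‖ = 1) {T : H →L[ℂ] H} {l m : ℂ}
    (h1 : ApproxEig U T l) (h2 : ApproxEig U T m) : l = m := by
  have h := (Tendsto.sub h1 h2).norm
  have h' : Tendsto (fun _ : H => ‖m - l‖) U (𝓝 0) := by
    rw [sub_zero, norm_zero] at h
    refine h.congr' ?_
    filter_upwards [hU] with x hx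
    rw [sub_sub_sub_cancel_left, ← sub_smul, norm_smul, hx, mul_one]
  have := tendsto_nhds_unique h' tendsto_const_nhds
  have := norm_eq_zero.1 this.symm
  exact (sub_eq_zero.1 this).symm

lemma isClosed_approxEig (hU : ∀ᶠ x in (U : Filter H), ‖x‖ = 1) :
    IsClosed {T : H →L[ℂ] H | ∃ l, ApproxEig U T l} := by
  refine isClosed_of_closure_subset fun T hT => ?_
  have hb : ∀ᶠ x in (U : Filter H), inner ℂ x (T x) ∈ Metric.closedBall (0 : ℂ) ‖T‖ := by
    filter_upwards [hU] with x hx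
    have := norm_inner_le_norm (𝕜 := ℂ) x (T x)
    have h2 := T.le_opNorm x
    rw [hx] at this h2
    simp only [mem_closedBall_zero_iff]
    linarith
  obtain ⟨l, -, hl⟩ := (isCompact_closedBall (0 : ℂ) ‖T‖).ultrafilter_le_nhds
    (U.map fun x => inner ℂ x (T x)) (by rw [le_principal_iff]; exact hb)
  have hl : Tendsto (fun x => inner ℂ x (T x)) (U : Filter H) (𝓝 l) := hl
  refine ⟨l, ?_⟩
  unfold ApproxEig
  rw [Metric.tendsto_nhds]
  intro ε hε
  obtain ⟨S, ⟨m, hS⟩, hTS⟩ := Metric.mem_closure_iff.1 hT (ε / 8) (by positivity)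
  rw [dist_eq_norm] at hTS
  have hS' := Metric.tendsto_nhds.1 hS (ε / 8) (by positivity)
  have hl' := Metric.tendsto_nhds.1 hl (ε / 8) (by positivity)
  filter_upwards [hU, hS', hl'] with x hx h1 h2
  rw [dist_zero_right] at h1 ⊢
  rw [dist_eq_norm] at h2
  have hts : ‖(T - S) x‖ ≤ ‖T - S‖ := by simpa [hx] using (T - S).le_opNorm x
  rw [sub_apply] at hts
  have e0 : T x - m • x = (T x - S x) + (S x - m • x) := by abel
  have e1 : ‖T x - m • x‖ < ε / 4 := by
    rw [e0]; exact (norm_add_le _ _).trans_lt (by linarith)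
  have e2 : ‖inner ℂ x (T x) - m‖ < ε / 4 := by
    have : inner ℂ x (T x) - m = inner ℂ x (T x - m • x) := by
      rw [inner_sub_right, inner_smul_right, inner_self_eq_norm_sq_to_K, hx]; simp
    rw [this]
    have := norm_inner_le_norm (𝕜 := ℂ) x (T x - m • x)
    rw [hx, one_mul] at this
    linarith
  have e3 : T x - l • x = (T x - m • x) - (inner ℂ x (T x) - m) • x + (inner ℂ x (T x) - l) • x := by
    rw [sub_smul, sub_smul]; abel
  have n1 : ‖(inner ℂ x (T x) - m) • x‖ = ‖inner ℂ x (T x) - m‖ := by rw [norm_smul, hx, mul_one]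
  have n2 : ‖(inner ℂ x (T x) - l) • x‖ = ‖inner ℂ x (T x) - l‖ := by rw [norm_smul, hx, mul_one]
  have f1 := norm_add_le ((T x - m • x) - (inner ℂ x (T x) - m) • x) ((inner ℂ x (T x) - l) • x)
  have f2 := norm_sub_le (T x - m • x) ((inner ℂ x (T x) - m) • x)
  rw [e3]
  linarith

lemma isBetweenZeroOne_scale {e : H →L[ℂ] H} (he : e.IsPositive) {M : ℝ} (hM : 0 < M)
    (heM : ‖e‖ ≤ M) : IsBetweenZeroOne (1 - ((M⁻¹ : ℝ) : ℂ) • e) := by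
  have hp : (((M⁻¹ : ℝ) : ℂ) • e).IsPositive :=
    he.smul_of_nonneg (by exact_mod_cast (inv_pos.2 hM).le)
  refine ⟨?_, by simpa using hp⟩
  refine ⟨(ContinuousLinearMap.isPositive_one.isSymmetric).sub hp.isSymmetric, fun x => ?_⟩
  change 0 ≤ (inner ℂ ((1 - ((M⁻¹ : ℝ) : ℂ) • e) x) x).re
  rw [re_inner_compl]
  have h1 : (inner ℂ ((((M⁻¹ : ℝ) : ℂ) • e) x) x).re ≤ ‖(((M⁻¹ : ℝ) : ℂ) • e) x‖ * ‖x‖ :=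
    (Complex.re_le_norm _).trans (norm_inner_le_norm _ _)
  have h2 : ‖(((M⁻¹ : ℝ) : ℂ) • e)‖ ≤ 1 := by
    rw [norm_smul, Complex.norm_real, Real.norm_of_nonneg (inv_pos.2 hM).le]
    rw [inv_mul_le_iff₀ hM]; linarith
  have h3 := (((M⁻¹ : ℝ) : ℂ) • e).le_opNorm x
  nlinarith [norm_nonneg x]

lemma re_lt_of_scale {e : H →L[ℂ] H} {M : ℝ} (hM : 0 < M) {x : H}
    (h : (inner ℂ ((1 - (1 - ((M⁻¹ : ℝ) : ℂ) • e)) x) x).re < M⁻¹) :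
    (inner ℂ (e x) x).re < 1 := by
  rw [sub_sub_cancel] at h
  change (inner ℂ (((M⁻¹ : ℝ) : ℂ) • e x) x).re < M⁻¹ at h
  rw [inner_smul_left, Complex.conj_ofReal, Complex.re_ofReal_mul] at h
  have := inv_pos.2 hM
  nlinarith

lemma exists_ultrafilter {C₁ C₂ C₃ : StarSubalgebra ℂ (H →L[ℂ] H)}
    (x₁ : characterSpace ℂ C₁) (x₂ : characterSpace ℂ C₂) (x₃ : characterSpace ℂ C₃)
    (hP : ∀ (a₁ : C₁) (a₂ : C₂) (a₃ : C₃),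
            IsBetweenZeroOne (a₁ : H →L[ℂ] H) → IsBetweenZeroOne (a₂ : H →L[ℂ] H) →
            IsBetweenZeroOne (a₃ : H →L[ℂ] H) →
            x₁ a₁ = 1 → x₂ a₂ = 1 → x₃ a₃ = 1 →
            ‖(a₁ : H →L[ℂ] H) * (a₂ : H →L[ℂ] H) * (a₃ : H →L[ℂ] H)‖ = 1) :
    ∃ U : Ultrafilter H, (∀ᶠ x in (U : Filter H), ‖x‖ = 1) ∧
      (∀ e : C₁, (e : H →L[ℂ] H).IsPositive → x₁ e = 0 →
        ∀ᶠ x in (U : Filter H), (inner ℂ ((e : H →L[ℂ] H) x) x).re < 1) ∧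
      (∀ e : C₂, (e : H →L[ℂ] H).IsPositive → x₂ e = 0 →
        ∀ᶠ x in (U : Filter H), (inner ℂ ((e : H →L[ℂ] H) x) x).re < 1) ∧
      (∀ e : C₃, (e : H →L[ℂ] H).IsPositive → x₃ e = 0 →
        ∀ᶠ x in (U : Filter H), (inner ℂ ((e : H →L[ℂ] H) x) x).re < 1) := by
  let I := {e : C₁ × C₂ × C₃ // ((e.1 : H →L[ℂ] H).IsPositive ∧ x₁ e.1 = 0) ∧
    ((e.2.1 : H →L[ℂ] H).IsPositive ∧ x₂ e.2.1 = 0) ∧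
    ((e.2.2 : H →L[ℂ] H).IsPositive ∧ x₃ e.2.2 = 0)}
  let B : I → Set H := fun e => {x | ‖x‖ = 1 ∧
    (inner ℂ ((e.1.1 : H →L[ℂ] H) x) x).re < 1 ∧
    (inner ℂ ((e.1.2.1 : H →L[ℂ] H) x) x).re < 1 ∧
    (inner ℂ ((e.1.2.2 : H →L[ℂ] H) x) x).re < 1}
  have hdir : Directed (· ≥ ·) (fun e => 𝓟 (B e)) := by
    rintro ⟨⟨e₁, e₂, e₃⟩, ⟨p₁, q₁⟩, ⟨p₂, q₂⟩, ⟨p₃, q₃⟩⟩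
      ⟨⟨f₁, f₂, f₃⟩, ⟨r₁, s₁⟩, ⟨r₂, s₂⟩, ⟨r₃, s₃⟩⟩
    refine ⟨⟨⟨e₁ + f₁, e₂ + f₂, e₃ + f₃⟩, ⟨p₁.add r₁, ?_⟩, ⟨p₂.add r₂, ?_⟩, ⟨p₃.add r₃, ?_⟩⟩,
      ?_, ?_⟩
    · change x₁ e₁ = 0 at q₁
      change x₁ f₁ = 0 at s₁
      change x₁ (e₁ + f₁) = 0
      rw [map_add, q₁, s₁, add_zero]
    · change x₂ e₂ = 0 at q₂
      change x₂ f₂ = 0 at s₂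
      change x₂ (e₂ + f₂) = 0
      rw [map_add, q₂, s₂, add_zero]
    · change x₃ e₃ = 0 at q₃
      change x₃ f₃ = 0 at s₃
      change x₃ (e₃ + f₃) = 0
      rw [map_add, q₃, s₃, add_zero]
    all_goals
      refine principal_mono.2 ?_
      rintro x ⟨hx, h1, h2, h3⟩
      have a1 := p₁.re_inner_nonneg_left x
      have a2 := p₂.re_inner_nonneg_left x
      have a3 := p₃.re_inner_nonneg_left x
      have b1 := r₁.re_inner_nonneg_left x
      have b2 := r₂.re_inner_nonneg_left x
      have b3 := r₃.re_inner_nonneg_left x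
      simp only [RCLike.re_to_complex] at a1 a2 a3 b1 b2 b3
      simp only [StarMemClass.coe_star, AddMemClass.coe_add, add_apply, inner_add_left, Complex.add_re]
        at h1 h2 h3
      refine ⟨hx, ?_, ?_, ?_⟩ <;> dsimp only <;> linarith
  have hne : ∀ e, (𝓟 (B e)).NeBot := by
    rintro ⟨⟨e₁, e₂, e₃⟩, ⟨p₁, q₁⟩, ⟨p₂, q₂⟩, ⟨p₃, q₃⟩⟩
    change x₁ e₁ = 0 at q₁
    change x₂ e₂ = 0 at q₂
    change x₃ e₃ = 0 at q₃
    rw [principal_neBot_iff]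
    obtain ⟨M, hM, k1, k2, k3⟩ : ∃ M : ℝ, 0 < M ∧ ‖(e₁ : H →L[ℂ] H)‖ ≤ M ∧
        ‖(e₂ : H →L[ℂ] H)‖ ≤ M ∧ ‖(e₃ : H →L[ℂ] H)‖ ≤ M := by
      have n1 := norm_nonneg (e₁ : H →L[ℂ] H)
      have n2 := norm_nonneg (e₂ : H →L[ℂ] H)
      have n3 := norm_nonneg (e₃ : H →L[ℂ] H)
      exact ⟨‖(e₁ : H →L[ℂ] H)‖ + ‖(e₂ : H →L[ℂ] H)‖ + ‖(e₃ : H →L[ℂ] H)‖ + 1, by linarith,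
        by linarith, by linarith, by linarith⟩
    have g1 := isBetweenZeroOne_scale p₁ hM k1
    have g2 := isBetweenZeroOne_scale p₂ hM k2
    have g3 := isBetweenZeroOne_scale p₃ hM k3
    have hn := hP (1 - ((M⁻¹ : ℝ) : ℂ) • e₁) (1 - ((M⁻¹ : ℝ) : ℂ) • e₂)
      (1 - ((M⁻¹ : ℝ) : ℂ) • e₃) g1 g2 g3
      (by rw [map_sub, map_one, map_smul, q₁, smul_zero, sub_zero])
      (by rw [map_sub, map_one, map_smul, q₂, smul_zero, sub_zero])
      (by rw [map_sub, map_one, map_smul, q₃, smul_zero, sub_zero])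
    obtain ⟨x, hx, h1, h2, h3⟩ := exists_unit_of_norm_eq_one g1 g2 g3 hn (inv_pos.2 hM)
    exact ⟨x, hx, re_lt_of_scale hM h1, re_lt_of_scale hM h2, re_lt_of_scale hM h3⟩
  have hF : (⨅ e, 𝓟 (B e)).NeBot := iInf_neBot_of_directed hdir hne
  have hmem : ∀ e, ∀ᶠ x in (Ultrafilter.of (⨅ e, 𝓟 (B e)) : Filter H), x ∈ B e := fun e =>
    Ultrafilter.of_le _ (mem_iInf_of_mem e (mem_principal_self _))
  have z : (0 : H →L[ℂ] H).IsPositive := ContinuousLinearMap.isPositive_zero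
  refine ⟨Ultrafilter.of (⨅ e, 𝓟 (B e)), ?_, fun e he he' => ?_, fun e he he' => ?_,
    fun e he he' => ?_⟩
  · exact (hmem ⟨⟨0, 0, 0⟩, ⟨z, map_zero _⟩, ⟨z, map_zero _⟩, ⟨z, map_zero _⟩⟩).mono
      fun x hx => hx.1
  · exact (hmem ⟨⟨e, 0, 0⟩, ⟨he, he'⟩, ⟨z, map_zero _⟩, ⟨z, map_zero _⟩⟩).mono
      fun x hx => hx.2.1
  · exact (hmem ⟨⟨0, e, 0⟩, ⟨z, map_zero _⟩, ⟨he, he'⟩, ⟨z, map_zero _⟩⟩).mono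
      fun x hx => hx.2.2.1
  · exact (hmem ⟨⟨0, 0, e⟩, ⟨z, map_zero _⟩, ⟨z, map_zero _⟩, ⟨he, he'⟩⟩).mono
      fun x hx => hx.2.2.2

lemma approxEig_of_char {C : StarSubalgebra ℂ (H →L[ℂ] H)} (x : characterSpace ℂ C)
    (h : ∀ e : C, (e : H →L[ℂ] H).IsPositive → x e = 0 →
        ∀ᶠ v in (U : Filter H), (inner ℂ ((e : H →L[ℂ] H) v) v).re < 1) (c : C) :
    ApproxEig U (c : H →L[ℂ] H) (x c) := by
  let d : C := c - algebraMap ℂ C (x c)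
  have hd : x d = 0 := by
    change x (c - algebraMap ℂ C (x c)) = 0
    rw [map_sub, AlgHomClass.commutes]; simp
  have hdc : ∀ v, (d : H →L[ℂ] H) v = (c : H →L[ℂ] H) v - x c • v := fun v => rfl
  unfold ApproxEig
  simp only [← hdc]
  rw [Metric.tendsto_nhds]
  intro ε hε
  have hp : ((((ε⁻¹ ^ 2 : ℝ) : ℂ) • (star d * d) : C) : H →L[ℂ] H).IsPositive := by
    refine ContinuousLinearMap.IsPositive.smul_of_nonneg
      (T := star (d : H →L[ℂ] H) * (d : H →L[ℂ] H)) ?_ ?_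
    · rw [← ContinuousLinearMap.nonneg_iff_isPositive]; exact star_mul_self_nonneg _
    · exact_mod_cast (by positivity : (0 : ℝ) ≤ ε⁻¹ ^ 2)
  have := h _ hp (by rw [map_smul, map_mul, hd, mul_zero, smul_zero])
  filter_upwards [this] with v hv
  change (inner ℂ ((((ε⁻¹ ^ 2 : ℝ) : ℂ)) • (ContinuousLinearMap.adjoint (d : H →L[ℂ] H))
    ((d : H →L[ℂ] H) v)) v).re < 1 at hv
  rw [inner_smul_left, Complex.conj_ofReal, Complex.re_ofReal_mul,
    ContinuousLinearMap.adjoint_inner_left, inner_self_eq_norm_sq_to_K] at hv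
  have hv : ε⁻¹ ^ 2 * ‖(d : H →L[ℂ] H) v‖ ^ 2 < 1 := by exact_mod_cast hv
  rw [dist_zero_right]
  rw [← mul_pow, sq_lt_one_iff₀ (by positivity), inv_mul_lt_iff₀ hε, mul_one] at hv
  exact hv

/-- The algebra homomorphism given by approximate eigenvalues. -/
lemma exists_algHom (hU : ∀ᶠ x in (U : Filter H), ‖x‖ = 1) (C : StarSubalgebra ℂ (H →L[ℂ] H))
    (h : ∀ c ∈ C, ∃ l, ApproxEig U c l) :
    ∃ f : C →ₐ[ℂ] ℂ, ∀ c : C, ApproxEig U (c : H →L[ℂ] H) (f c) := by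
  choose! f hf using h
  have hf' : ∀ c : C, ApproxEig U (c : H →L[ℂ] H) (f c) := fun c => hf c c.2
  have hc : ∀ r : ℂ, f (algebraMap ℂ C r : C) = r := fun r =>
    (hf' _).unique hU (approxEig_algebraMap r)
  refine ⟨{ toFun := fun c => f c, map_one' := ?_, map_mul' := ?_, map_zero' := ?_,
            map_add' := ?_, commutes' := hc }, hf'⟩
  · simpa using hc 1
  · exact fun a b => (hf' _).unique hU ((hf' a).mul (hf' b))
  · simpa using hc 0
  · exact fun a b => (hf' _).unique hU ((hf' a).add (hf' b))

/-- Induction principle for the generated C*-algebra, avoiding the star. -/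
lemma gen_induction {C₁ C₂ C₃ : StarSubalgebra ℂ (H →L[ℂ] H)} {Q : Set (H →L[ℂ] H)}
    (hQ : IsClosed Q) (h₁ : ∀ c ∈ C₁, c ∈ Q) (h₂ : ∀ c ∈ C₂, c ∈ Q) (h₃ : ∀ c ∈ C₃, c ∈ Q)
    (halg : ∀ r, algebraMap ℂ (H →L[ℂ] H) r ∈ Q)
    (hadd : ∀ a b, a ∈ Q → b ∈ Q → a + b ∈ Q) (hmul : ∀ a b, a ∈ Q → b ∈ Q → a * b ∈ Q) :
    closure (StarAlgebra.adjoin ℂ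
        ((C₁ : Set (H →L[ℂ] H)) ∪ (C₂ : Set (H →L[ℂ] H)) ∪ (C₃ : Set (H →L[ℂ] H)))
        : Set (H →L[ℂ] H)) ⊆ Q := by
  refine closure_minimal (fun T hT => ?_) hQ
  change T ∈ Algebra.adjoin ℂ _ at hT
  have hs : ∀ c ∈ ((C₁ : Set (H →L[ℂ] H)) ∪ C₂ ∪ C₃), c ∈ Q := by
    rintro c ((hc | hc) | hc)
    exacts [h₁ c hc, h₂ c hc, h₃ c hc]
  refine Algebra.adjoin_induction (p := fun x _ => x ∈ Q) ?_ halg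
    (fun a b _ _ => hadd a b) (fun a b _ _ => hmul a b) hT
  rintro c (hc | hc)
  · exact hs c hc
  · refine hs c ?_
    rcases hc with (hc | hc) | hc
    · exact Or.inl (Or.inl (by simpa using star_mem (S := StarSubalgebra ℂ (H →L[ℂ] H)) (s := C₁) hc))
    · exact Or.inl (Or.inr (by simpa using star_mem (S := StarSubalgebra ℂ (H →L[ℂ] H)) (s := C₂) hc))
    · exact Or.inr (by simpa using star_mem (S := StarSubalgebra ℂ (H →L[ℂ] H)) (s := C₃) hc)

end PowerAux

/-- **Power's theorem.** Let `C₁, C₂, C₃` be unital C*-subalgebras of `B(H)` (`H` a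
separable Hilbert space) with nonempty character spaces, and let `C` be the C*-algebra they
generate. Then the maximal ideal space of the commutative C*-algebra `C̃ = C / com(C)`
— equivalently (since characters kill commutators) the character space of `C` —
is homeomorphic to the set `P(C₁,C₂,C₃)` of triples
`(x₁,x₂,x₃) ∈ M(C₁) × M(C₂) × M(C₃)` such that whenever `aᵢ ∈ Cᵢ` with `0 ≤ aᵢ ≤ 1` and
`xᵢ(aᵢ) = 1` for `i = 1,2,3`, one has `‖a₁a₂a₃‖ = 1`. -/
theorem power_theorem
    {H : Type*} [NormedAddCommGroup H] [InnerProductSpace ℂ H] [CompleteSpace H]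
    [TopologicalSpace.SeparableSpace H]
    (C₁ C₂ C₃ : StarSubalgebra ℂ (H →L[ℂ] H))
    (hC₁ : IsClosed (C₁ : Set (H →L[ℂ] H))) (hC₂ : IsClosed (C₂ : Set (H →L[ℂ] H)))
    (hC₃ : IsClosed (C₃ : Set (H →L[ℂ] H)))
    (hM₁ : Nonempty (characterSpace ℂ C₁)) (hM₂ : Nonempty (characterSpace ℂ C₂))
    (hM₃ : Nonempty (characterSpace ℂ C₃))
    (C : StarSubalgebra ℂ (H →L[ℂ] H))
    (hC : (C : Set (H →L[ℂ] H)) =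
      closure (StarAlgebra.adjoin ℂ
        ((C₁ : Set (H →L[ℂ] H)) ∪ (C₂ : Set (H →L[ℂ] H)) ∪ (C₃ : Set (H →L[ℂ] H)))
        : Set (H →L[ℂ] H))) :
    Nonempty
      (characterSpace ℂ C ≃ₜ
        {p : characterSpace ℂ C₁ × characterSpace ℂ C₂ × characterSpace ℂ C₃ //
          ∀ (a₁ : C₁) (a₂ : C₂) (a₃ : C₃),
            IsBetweenZeroOne (a₁ : H →L[ℂ] H) → IsBetweenZeroOne (a₂ : H →L[ℂ] H) →
            IsBetweenZeroOne (a₃ : H →L[ℂ] H) →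
            p.1 a₁ = 1 → p.2.1 a₂ = 1 → p.2.2 a₃ = 1 →
            ‖(a₁ : H →L[ℂ] H) * (a₂ : H →L[ℂ] H) * (a₃ : H →L[ℂ] H)‖ = 1}) := by
  haveI : CompleteSpace C₁ := hC₁.completeSpace_coe
  haveI : CompleteSpace C₂ := hC₂.completeSpace_coe
  haveI : CompleteSpace C₃ := hC₃.completeSpace_coe
  have hCc : IsClosed (C : Set (H →L[ℂ] H)) := by rw [hC]; exact isClosed_closure
  haveI : CompleteSpace C := hCc.completeSpace_coe
  have hsub : ∀ T, T ∈ ((C₁ : Set (H →L[ℂ] H)) ∪ (C₂ : Set (H →L[ℂ] H)) ∪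
      (C₃ : Set (H →L[ℂ] H))) → T ∈ C := fun T hT => by
    change T ∈ (C : Set (H →L[ℂ] H))
    rw [hC]
    exact subset_closure (StarAlgebra.subset_adjoin ℂ _ hT)
  have le₁ : C₁ ≤ C := fun T hT => hsub T (Or.inl (Or.inl hT))
  have le₂ : C₂ ≤ C := fun T hT => hsub T (Or.inl (Or.inr hT))
  have le₃ : C₃ ≤ C := fun T hT => hsub T (Or.inr hT)
  let r₁ := CharacterSpace.compContinuousMap (StarSubalgebra.inclusion le₁)
  let r₂ := CharacterSpace.compContinuousMap (StarSubalgebra.inclusion le₂)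
  let r₃ := CharacterSpace.compContinuousMap (StarSubalgebra.inclusion le₃)
  have a₁ : ∀ (φ : characterSpace ℂ C) (c : C₁), r₁ φ c = φ ⟨c, le₁ c.2⟩ := fun _ _ => rfl
  have a₂ : ∀ (φ : characterSpace ℂ C) (c : C₂), r₂ φ c = φ ⟨c, le₂ c.2⟩ := fun _ _ => rfl
  have a₃ : ∀ (φ : characterSpace ℂ C) (c : C₃), r₃ φ c = φ ⟨c, le₃ c.2⟩ := fun _ _ => rfl
  have hmaps : ∀ φ : characterSpace ℂ C, ∀ (b₁ : C₁) (b₂ : C₂) (b₃ : C₃),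
      IsBetweenZeroOne (b₁ : H →L[ℂ] H) → IsBetweenZeroOne (b₂ : H →L[ℂ] H) →
      IsBetweenZeroOne (b₃ : H →L[ℂ] H) →
      r₁ φ b₁ = 1 → r₂ φ b₂ = 1 → r₃ φ b₃ = 1 →
      ‖(b₁ : H →L[ℂ] H) * (b₂ : H →L[ℂ] H) * (b₃ : H →L[ℂ] H)‖ = 1 := by
    intro φ b₁ b₂ b₃ h₁ h₂ h₃ e₁ e₂ e₃
    rw [a₁] at e₁
    rw [a₂] at e₂
    rw [a₃] at e₃
    have hnt : Nontrivial H := by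
      by_contra hH
      rw [not_nontrivial_iff_subsingleton] at hH
      have h10 : (1 : C) = 0 := Subtype.ext (ContinuousLinearMap.ext fun v => Subsingleton.elim _ _)
      have := map_one φ
      rw [h10, map_zero] at this
      exact zero_ne_one this
    haveI : NormOneClass C := ⟨by change ‖(1 : H →L[ℂ] H)‖ = 1; exact norm_one⟩
    apply le_antisymm
    · have n1 := h₁.norm_le_one
      have n2 := h₂.norm_le_one
      have n3 := h₃.norm_le_one
      calc _ ≤ ‖(b₁ : H →L[ℂ] H)‖ * ‖(b₂ : H →L[ℂ] H)‖ * ‖(b₃ : H →L[ℂ] H)‖ := norm_mul₃_le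
        _ ≤ 1 * 1 * 1 := by gcongr
        _ = 1 := by norm_num
    · have := AlgHom.norm_apply_le_self φ
        ((⟨b₁, le₁ b₁.2⟩ : C) * ⟨b₂, le₂ b₂.2⟩ * ⟨b₃, le₃ b₃.2⟩)
      rw [map_mul, map_mul, e₁, e₂, e₃] at this
      simpa using this
  let F : characterSpace ℂ C →
      {p : characterSpace ℂ C₁ × characterSpace ℂ C₂ × characterSpace ℂ C₃ //
          ∀ (a₁ : C₁) (a₂ : C₂) (a₃ : C₃),
            IsBetweenZeroOne (a₁ : H →L[ℂ] H) → IsBetweenZeroOne (a₂ : H →L[ℂ] H) →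
            IsBetweenZeroOne (a₃ : H →L[ℂ] H) →
            p.1 a₁ = 1 → p.2.1 a₂ = 1 → p.2.2 a₃ = 1 →
            ‖(a₁ : H →L[ℂ] H) * (a₂ : H →L[ℂ] H) * (a₃ : H →L[ℂ] H)‖ = 1} :=
    fun φ => ⟨(r₁ φ, r₂ φ, r₃ φ), hmaps φ⟩
  have hFc : Continuous F :=
    (r₁.continuous.prodMk (r₂.continuous.prodMk r₃.continuous)).subtype_mk _
  have hinj : Function.Injective F := by
    intro φ ψ h
    have h := congrArg Subtype.val h
    have k₁ : r₁ φ = r₁ ψ := congrArg (fun p => p.1) h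
    have k₂ : r₂ φ = r₂ ψ := congrArg (fun p => p.2.1) h
    have k₃ : r₃ φ = r₃ ψ := congrArg (fun p => p.2.2) h
    let Q : Set (H →L[ℂ] H) := Subtype.val '' {c : C | φ c = ψ c}
    have hQ : IsClosed Q := hCc.isClosedMap_subtype_val _
      (isClosed_eq (map_continuous φ) (map_continuous ψ))
    have hCQ := gen_induction (C₁ := C₁) (C₂ := C₂) (C₃ := C₃) hQ
      (fun c hc => ⟨⟨c, le₁ hc⟩, by
        have := congrArg (fun f : characterSpace ℂ C₁ => f ⟨c, hc⟩) k₁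
        exact this, rfl⟩)
      (fun c hc => ⟨⟨c, le₂ hc⟩, by
        have := congrArg (fun f : characterSpace ℂ C₂ => f ⟨c, hc⟩) k₂
        exact this, rfl⟩)
      (fun c hc => ⟨⟨c, le₃ hc⟩, by
        have := congrArg (fun f : characterSpace ℂ C₃ => f ⟨c, hc⟩) k₃
        exact this, rfl⟩)
      (fun r => ⟨algebraMap ℂ C r, by
        change φ _ = ψ _
        rw [AlgHomClass.commutes, AlgHomClass.commutes], rfl⟩)
      (by
        rintro _ _ ⟨a, ha, rfl⟩ ⟨b, hb, rfl⟩
        refine ⟨a + b, ?_, rfl⟩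
        change φ _ = ψ _
        change φ _ = ψ _ at ha
        change φ _ = ψ _ at hb
        rw [map_add, map_add, ha, hb])
      (by
        rintro _ _ ⟨a, ha, rfl⟩ ⟨b, hb, rfl⟩
        refine ⟨a * b, ?_, rfl⟩
        change φ _ = ψ _
        change φ _ = ψ _ at ha
        change φ _ = ψ _ at hb
        rw [map_mul, map_mul, ha, hb])
    rw [← hC] at hCQ
    refine CharacterSpace.ext fun c => ?_
    obtain ⟨d, hd, hdc⟩ := hCQ c.2
    have : d = c := Subtype.ext hdc
    rw [← this]
    exact hd
  have hsurj : Function.Surjective F := by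
    rintro ⟨⟨x₁, x₂, x₃⟩, hP⟩
    obtain ⟨U, hU, u₁, u₂, u₃⟩ := exists_ultrafilter x₁ x₂ x₃ hP
    have v₁ := approxEig_of_char x₁ u₁
    have v₂ := approxEig_of_char x₂ u₂
    have v₃ := approxEig_of_char x₃ u₃
    have hCQ := gen_induction (C₁ := C₁) (C₂ := C₂) (C₃ := C₃) (isClosed_approxEig hU)
      (fun c hc => ⟨_, v₁ ⟨c, hc⟩⟩) (fun c hc => ⟨_, v₂ ⟨c, hc⟩⟩) (fun c hc => ⟨_, v₃ ⟨c, hc⟩⟩)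
      (fun r => ⟨r, approxEig_algebraMap r⟩)
      (fun a b ⟨l, hl⟩ ⟨m, hm⟩ => ⟨l + m, hl.add hm⟩)
      (fun a b ⟨l, hl⟩ ⟨m, hm⟩ => ⟨l * m, hl.mul hm⟩)
    rw [← hC] at hCQ
    obtain ⟨f, hf⟩ := exists_algHom hU C (fun c hc => hCQ hc)
    refine ⟨CharacterSpace.equivAlgHom.symm f, Subtype.ext ?_⟩
    refine Prod.ext ?_ (Prod.ext ?_ ?_)
    · refine CharacterSpace.ext fun c => ?_
      exact (hf ⟨c, le₁ c.2⟩).unique hU (v₁ c)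
    · refine CharacterSpace.ext fun c => ?_
      exact (hf ⟨c, le₂ c.2⟩).unique hU (v₂ c)
    · refine CharacterSpace.ext fun c => ?_
      exact (hf ⟨c, le₃ c.2⟩).unique hU (v₃ c)
  exact ⟨Continuous.homeoOfEquivCompactToT2 (f := Equiv.ofBijective F ⟨hinj, hsurj⟩) hFc⟩
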